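/- arXiv:1301.3305 — 2 statements merged into one kernel-verified Lean document; each statement's English description precedes it below -/
import Mathlib

section
/- Let (A, m) be a one-dimensional Noetherian local Gorenstein ring which is not regular, and let R = { r ∈ Q(A) | r·m ⊆ m }. Then there is a short exact sequence of A-modules 0 → A → R → A/m → 0, where A → R is the inclusion; in particular length_A(R/A) = 1. -/
set_option synthInstance.maxHeartbeats 400000

open IsLocalRing CategoryTheory

/-- `Ext¹_A(M, N)` for `A`-modules `M`, `N`. -/
noncomputable abbrev ext1 (A : Type*) [CommRing A] (M N : ModuleCat A) : ModuleCat A :=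
  ((Ext A (ModuleCat A) 1).obj (Opposite.op M)).obj N

/-- A one-dimensional local ring `A` is Gorenstein if it is Cohen–Macaulay
(`Hom_A(k, A) = 0` where `k = A/m` is the residue field) and `Ext¹_A(k, A) ≅ k`. -/
def IsGorensteinOneDim (A : Type*) [CommRing A] [IsLocalRing A] : Prop :=
  (∀ f : (A ⧸ maximalIdeal A) →ₗ[A] A, f = 0) ∧
  Nonempty (ext1 A (ModuleCat.of A (A ⧸ maximalIdeal A)) (ModuleCat.of A A) ≅
    ModuleCat.of A (A ⧸ maximalIdeal A))

/-- The subring `R = { r ∈ Q(A) | r·m ⊆ m }` of the total ring of fractions of a local ring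
`A`, regarded as an `A`-submodule of `Q(A)`. -/
def stabilizerOfMaximalIdeal (A : Type*) [CommRing A] [IsLocalRing A] :
    Submodule A (Localization (nonZeroDivisors A)) where
  carrier := { r : Localization (nonZeroDivisors A) |
    ∀ a ∈ maximalIdeal A, ∃ b ∈ maximalIdeal A,
      r * algebraMap A (Localization (nonZeroDivisors A)) a =
        algebraMap A (Localization (nonZeroDivisors A)) b }
  add_mem' := by
    intro r s hr hs a ha
    obtain ⟨b, hb, hrb⟩ := hr a ha
    obtain ⟨c, hc, hsc⟩ := hs a ha
    exact ⟨b + c, Ideal.add_mem _ hb hc, by rw [add_mul, hrb, hsc, map_add]⟩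
  zero_mem' := by
    intro a ha
    exact ⟨0, Ideal.zero_mem _, by rw [zero_mul, map_zero]⟩
  smul_mem' := by
    intro c r hr a ha
    obtain ⟨b, hb, hrb⟩ := hr a ha
    refine ⟨c * b, Ideal.mul_mem_left _ _ hb, ?_⟩
    rw [Algebra.smul_def, mul_assoc, hrb, ← map_mul]

/-- If `r` multiplies `m` into `A` and `m` is not principal, then `r` stabilizes `m`. -/
lemma mem_stab_of_mul {A : Type*} [CommRing A] [IsLocalRing A]
    (hnotreg : ¬ (maximalIdeal A).IsPrincipal) (r : Localization (nonZeroDivisors A))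
    (h : ∀ a ∈ maximalIdeal A, ∃ b, r * algebraMap A (Localization (nonZeroDivisors A)) a =
        algebraMap A (Localization (nonZeroDivisors A)) b) :
    r ∈ stabilizerOfMaximalIdeal A := by
  have hinj := IsLocalization.injective (Localization (nonZeroDivisors A))
    (le_refl (nonZeroDivisors A))
  intro a ha
  obtain ⟨b, hb⟩ := h a ha
  refine ⟨b, ?_, hb⟩
  by_contra hbm
  have hu : IsUnit b := by
    by_contra hu
    exact hbm ((mem_maximalIdeal b).2 hu)
  obtain ⟨c, hc⟩ := hu.exists_left_inv
  apply hnotreg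
  refine ⟨⟨a, le_antisymm ?_ ?_⟩⟩
  · intro y hy
    obtain ⟨e, he⟩ := h y hy
    rw [Submodule.mem_span_singleton]
    refine ⟨c * e, hinj ?_⟩
    have h1 : algebraMap A (Localization (nonZeroDivisors A)) c *
        algebraMap A (Localization (nonZeroDivisors A)) b = 1 := by
      rw [← map_mul, hc, map_one]
    rw [smul_eq_mul, map_mul, map_mul, ← he]
    rw [← hb] at h1
    linear_combination (algebraMap A (Localization (nonZeroDivisors A)) y) * h1
  · rw [Submodule.span_singleton_le_iff_mem]
    exact ha

lemma exists_mulMap (A : Type*) [CommRing A] [IsLocalRing A] :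
    ∃ μ : stabilizerOfMaximalIdeal A →ₗ[A] (maximalIdeal A) →ₗ[A] A,
      ∀ r a, algebraMap A (Localization (nonZeroDivisors A)) (μ r a) =
        (r : Localization (nonZeroDivisors A)) *
          algebraMap A (Localization (nonZeroDivisors A)) (a : A) := by
  have hinj := IsLocalization.injective (Localization (nonZeroDivisors A))
    (le_refl (nonZeroDivisors A))
  have h : ∀ (r : stabilizerOfMaximalIdeal A) (a : maximalIdeal A), ∃ b : A,
      algebraMap A (Localization (nonZeroDivisors A)) b =
        (r : Localization (nonZeroDivisors A)) *
          algebraMap A (Localization (nonZeroDivisors A)) (a : A) := by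
    intro r a
    obtain ⟨b, _, hb⟩ := r.2 a.1 a.2
    exact ⟨b, hb.symm⟩
  choose β hβ using h
  refine ⟨LinearMap.mk₂ A β ?_ ?_ ?_ ?_, fun r a => hβ r a⟩
  · intro r s a
    apply hinj
    rw [map_add, hβ, hβ, hβ, Submodule.coe_add, add_mul]
  · intro c r a
    apply hinj
    rw [smul_eq_mul, map_mul, hβ, hβ, Submodule.coe_smul, Algebra.smul_def, mul_assoc]
  · intro r a b
    apply hinj
    rw [map_add, hβ, hβ, hβ, Submodule.coe_add, map_add, mul_add]
  · intro c r a
    apply hinj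
    rw [smul_eq_mul, map_mul, hβ, hβ, Submodule.coe_smul, smul_eq_mul, map_mul]
    ring

lemma core_resolution (A : Type*) [CommRing A] [IsLocalRing A]
    (hreg : ∃ a ∈ maximalIdeal A, a ∈ nonZeroDivisors A)
    (hnotreg : ¬ (maximalIdeal A).IsPrincipal)
    {P0 P1 P2 : Type*} [AddCommGroup P0] [AddCommGroup P1] [AddCommGroup P2]
    [Module A P0] [Module A P1] [Module A P2] [Module.Projective A P0]
    (d1 : P1 →ₗ[A] P0) (d2 : P2 →ₗ[A] P1) (ε : P0 →ₗ[A] (A ⧸ maximalIdeal A))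
    (h21 : Function.Exact d2 d1) (h10 : Function.Exact d1 ε) (hε : Function.Surjective ε) :
    ∃ θ : stabilizerOfMaximalIdeal A →ₗ[A] (P1 →ₗ[A] A),
      (∀ r, (θ r) ∘ₗ d2 = 0) ∧
      (∀ f : P1 →ₗ[A] A, f ∘ₗ d2 = 0 → ∃ r, ∃ g : P0 →ₗ[A] A, f = θ r + g ∘ₗ d1) ∧
      (∀ r, (∃ g : P0 →ₗ[A] A, g ∘ₗ d1 = θ r) ↔
        ∃ a : A, algebraMap A (Localization (nonZeroDivisors A)) a = r) := by
  have hinj := IsLocalization.injective (Localization (nonZeroDivisors A))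
    (le_refl (nonZeroDivisors A))
  obtain ⟨x, hxm, hx⟩ := hreg
  obtain ⟨μ, hμ⟩ := exists_mulMap A
  obtain ⟨φ, hφ⟩ := Module.projective_lifting_property (maximalIdeal A).mkQ ε
    (Submodule.mkQ_surjective _)
  have hφm : ∀ p, φ p ∈ maximalIdeal A ↔ ε p = 0 := by
    intro p
    rw [← hφ, LinearMap.comp_apply, Submodule.mkQ_apply, Submodule.Quotient.mk_eq_zero]
  -- element with `φ p0 = 1`
  obtain ⟨p0, hp0⟩ : ∃ p0, φ p0 = 1 := by
    obtain ⟨q, hq⟩ := hε (Submodule.Quotient.mk 1)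
    have hu : IsUnit (φ q) := by
      by_contra hu
      have h0 := (hφm q).1 ((mem_maximalIdeal _).2 hu)
      rw [hq, Submodule.Quotient.mk_eq_zero] at h0
      exact (Ideal.ne_top_iff_one _).1 (maximalIdeal.isMaximal A).ne_top h0
    obtain ⟨c, hc⟩ := hu.exists_left_inv
    exact ⟨c • q, by rw [map_smul, smul_eq_mul, hc]⟩
  have hd : ∀ y, (φ ∘ₗ d1) y ∈ maximalIdeal A := fun y => (hφm _).2 (h10.apply_apply_eq_zero y)
  let δ : P1 →ₗ[A] maximalIdeal A := (φ ∘ₗ d1).codRestrict (maximalIdeal A) hd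
  have hδ : ∀ y, ((δ y : maximalIdeal A) : A) = φ (d1 y) := fun y => rfl
  have hθ : ∀ r y, algebraMap A (Localization (nonZeroDivisors A)) (μ r (δ y)) =
      (r : Localization (nonZeroDivisors A)) *
        algebraMap A (Localization (nonZeroDivisors A)) (φ (d1 y)) := fun r y => by
    rw [hμ, hδ]
  have hK : ∀ a ∈ maximalIdeal A, ∃ y, d1 y = a • p0 := by
    intro a ha
    refine (h10 (a • p0)).1 ((hφm _).1 ?_)
    rw [map_smul, hp0, smul_eq_mul, mul_one]
    exact ha
  refine ⟨(LinearMap.lcomp A A δ) ∘ₗ μ, ?_, ?_, ?_⟩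
  · intro r
    ext y
    apply hinj
    change algebraMap A (Localization (nonZeroDivisors A)) (μ r (δ (d2 y))) = _
    rw [hθ, h21.apply_apply_eq_zero]
    simp
  · intro f hf
    have hker : LinearMap.ker d1 ≤ LinearMap.ker f := by
      intro y hy
      obtain ⟨z, rfl⟩ := (h21 y).1 hy
      exact LinearMap.congr_fun hf z
    let F : LinearMap.range d1 →ₗ[A] A :=
      ((LinearMap.ker d1).liftQ f hker) ∘ₗ d1.quotKerEquivRange.symm.toLinearMap
    have hF : ∀ y, F ⟨d1 y, LinearMap.mem_range_self d1 y⟩ = f y := by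
      intro y
      have : d1.quotKerEquivRange.symm ⟨d1 y, LinearMap.mem_range_self d1 y⟩ =
          Submodule.Quotient.mk y := by
        rw [LinearEquiv.symm_apply_eq]
        rfl
      change (LinearMap.ker d1).liftQ f hker (d1.quotKerEquivRange.symm _) = _
      rw [this]
      rfl
    have hpr : ∀ p, (LinearMap.id - φ.smulRight p0 : P0 →ₗ[A] P0) p ∈ LinearMap.range d1 := by
      intro p
      refine (h10 _).1 ((hφm _).1 ?_)
      simp [hp0]
    let g : P0 →ₗ[A] A := F ∘ₗ (LinearMap.id - φ.smulRight p0).codRestrict _ hpr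
    obtain ⟨y0, hy0⟩ := hK x hxm
    let r : Localization (nonZeroDivisors A) := IsLocalization.mk' _ (f y0) ⟨x, hx⟩
    have hrx : r * algebraMap A _ x = algebraMap A _ (f y0) := IsLocalization.mk'_spec _ _ _
    have hxu : IsUnit (algebraMap A (Localization (nonZeroDivisors A)) x) :=
      IsLocalization.map_units _ (⟨x, hx⟩ : nonZeroDivisors A)
    -- `f` of preimage of `a p0`
    have hra : ∀ a y, d1 y = a • p0 → r * algebraMap A _ a = algebraMap A _ (f y) := by
      intro a y hy
      have h1 : x * f y = a * f y0 := by
        rw [← smul_eq_mul, ← smul_eq_mul, ← map_smul, ← map_smul, ← sub_eq_zero, ← map_sub]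
        refine hker ?_
        rw [LinearMap.mem_ker, map_sub, map_smul, map_smul, hy, hy0, smul_smul, smul_smul,
          mul_comm, sub_self]
      have h2 := congrArg (algebraMap A (Localization (nonZeroDivisors A))) h1
      rw [map_mul, map_mul, ← hrx] at h2
      apply hxu.mul_left_cancel
      rw [h2]
      ring
    have hrR : r ∈ stabilizerOfMaximalIdeal A := by
      apply mem_stab_of_mul hnotreg
      intro a ha
      obtain ⟨y, hy⟩ := hK a ha
      exact ⟨f y, hra a y hy⟩
    refine ⟨⟨r, hrR⟩, g, ?_⟩
    ext y
    apply hinj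
    change _ = algebraMap A (Localization (nonZeroDivisors A)) (μ ⟨r, hrR⟩ (δ y) + g (d1 y))
    rw [map_add, hθ]
    obtain ⟨z, hz⟩ := hK (φ (d1 y)) (hd y)
    have hg : g (d1 y) = f (y - z) := by
      rw [← hF]
      change F _ = F _
      congr 1
      apply Subtype.ext
      simp [hz]
    rw [hg, hra _ z hz, ← map_add, map_sub]
    simp
  · intro r
    constructor
    · rintro ⟨g, hg⟩
      refine ⟨g p0, ?_⟩
      obtain ⟨y, hy⟩ := hK x hxm
      have h1 : g (d1 y) = μ r (δ y) := LinearMap.congr_fun hg y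
      have h2 := congrArg (algebraMap A (Localization (nonZeroDivisors A))) h1
      rw [hθ, hy, map_smul g, map_smul φ, hp0, smul_eq_mul, smul_eq_mul, mul_one, map_mul,
        mul_comm] at h2
      exact (IsLocalization.map_units _ (⟨x, hx⟩ : nonZeroDivisors A)).mul_right_cancel h2
    · rintro ⟨a, ha⟩
      refine ⟨a • φ, ?_⟩
      ext y
      apply hinj
      change algebraMap A (Localization (nonZeroDivisors A)) (a * φ (d1 y)) =
        algebraMap A (Localization (nonZeroDivisors A)) (μ r (δ y))
      rw [hθ, ← ha, map_mul]

lemma shortComplex_homology {A : Type*} [CommRing A] (S : ShortComplex (ModuleCat A)) :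
    ∃ q : LinearMap.ker S.g.hom →ₗ[A] S.homology, Function.Surjective q ∧
      ∀ z, q z = 0 ↔ ∃ y, S.f y = z.1 := by
  let e : (LinearMap.ker S.g.hom ⧸ LinearMap.range S.moduleCatToCycles) ≃ₗ[A] S.homology :=
    S.moduleCatHomologyIso.symm.toLinearEquiv
  refine ⟨e.toLinearMap ∘ₗ Submodule.mkQ _, ?_, ?_⟩
  · exact e.surjective.comp (Submodule.mkQ_surjective _)
  · intro z
    rw [LinearMap.comp_apply, LinearEquiv.coe_coe, LinearEquiv.map_eq_zero_iff,
      Submodule.mkQ_apply, Submodule.Quotient.mk_eq_zero, LinearMap.mem_range]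
    constructor
    · rintro ⟨y, hy⟩
      exact ⟨y, congrArg Subtype.val hy⟩
    · rintro ⟨y, hy⟩
      exact ⟨y, Subtype.ext hy⟩

lemma exists_stab_to_ext (A : Type*) [CommRing A] [IsLocalRing A]
    (hreg : ∃ a ∈ maximalIdeal A, a ∈ nonZeroDivisors A)
    (hnotreg : ¬ (maximalIdeal A).IsPrincipal) :
    ∃ π : stabilizerOfMaximalIdeal A →ₗ[A]
        ext1 A (ModuleCat.of A (A ⧸ maximalIdeal A)) (ModuleCat.of A A),
      Function.Surjective π ∧ ∀ r, π r = 0 ↔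
        ∃ a : A, algebraMap A (Localization (nonZeroDivisors A)) a = r := by
  let P := ProjectiveResolution.of (ModuleCat.of A (A ⧸ maximalIdeal A))
  let C := P.complex.linearYonedaObj A (ModuleCat.of A A)
  have hP0 : Module.Projective A (P.complex.X 0) :=
    (IsProjective.iff_projective _).2 (P.projective 0)
  have h21 : Function.Exact (P.complex.d 2 1).hom (P.complex.d 1 0).hom :=
    (ShortComplex.ShortExact.moduleCat_exact_iff_function_exact _).1 (P.exact_succ 0)
  have h10 : Function.Exact (P.complex.d 1 0).hom (P.π.f 0).hom :=
    (ShortComplex.ShortExact.moduleCat_exact_iff_function_exact _).1 P.exact₀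
  have hε : Function.Surjective (P.π.f 0).hom :=
    (ModuleCat.epi_iff_surjective _).1 inferInstance
  obtain ⟨θ, hθ1, hθ2, hθ3⟩ := core_resolution A hreg hnotreg (P.complex.d 1 0).hom
    (P.complex.d 2 1).hom (P.π.f 0).hom h21 h10 hε
  let S := C.sc' 0 1 2
  obtain ⟨q, hq1, hq2⟩ := shortComplex_homology S
  let e : S.homology ≅ ext1 A (ModuleCat.of A (A ⧸ maximalIdeal A)) (ModuleCat.of A A) :=
    (C.homologyIsoSc' 0 1 2 (by simp) (by simp)).symm ≪≫ (P.isoExt 1 _).symm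
  let E := e.toLinearEquiv
  let u : (P.complex.X 1 →ₗ[A] A) ≃ₗ[A] S.X₂ :=
    (ModuleCat.homLinearEquiv (S := A) (M := P.complex.X 1) (N := ModuleCat.of A A)).symm
  have hθ : ∀ r, (u.toLinearMap ∘ₗ θ) r ∈ LinearMap.ker S.g.hom := by
    intro r
    rw [LinearMap.mem_ker]
    exact ModuleCat.hom_ext (hθ1 r)
  refine ⟨E.toLinearMap ∘ₗ q ∘ₗ (u.toLinearMap ∘ₗ θ).codRestrict _ hθ, ?_, ?_⟩
  · refine E.surjective.comp ?_
    intro h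
    obtain ⟨z, rfl⟩ := hq1 h
    obtain ⟨r, g, hg⟩ := hθ2 (u.symm z.1) (by
      have := z.2
      rw [LinearMap.mem_ker] at this
      exact congrArg ModuleCat.Hom.hom this)
    refine ⟨r, ?_⟩
    rw [← sub_eq_zero, LinearMap.comp_apply, ← map_sub, hq2]
    refine ⟨ModuleCat.ofHom (-g), ?_⟩
    apply u.symm.injective
    change -g ∘ₗ (P.complex.d 1 0).hom = θ r - u.symm z.1
    rw [hg]
    ext y
    simp
  · intro r
    rw [LinearMap.comp_apply, LinearEquiv.coe_coe, LinearEquiv.map_eq_zero_iff,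
      LinearMap.comp_apply, hq2, ← hθ3]
    constructor
    · rintro ⟨y, hy⟩
      exact ⟨ModuleCat.Hom.hom y, congrArg ModuleCat.Hom.hom hy⟩
    · rintro ⟨g, hg⟩
      exact ⟨ModuleCat.ofHom g, ModuleCat.hom_ext hg⟩

/-- Let `(A, m)` be a one-dimensional Noetherian local Gorenstein ring which is
not regular (for a one-dimensional Noetherian local ring, regular means that `m` is principal),
and let `R = { r ∈ Q(A) | r·m ⊆ m }`.  Then there is a short exact sequence of `A`-modules
`0 → A → R → A/m → 0`, where `A → R` is the inclusion (induced by the canonical map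
`A → Q(A)`); in particular `length_A(R/A) = 1`. -/
theorem exact_seq_minimal_overring
    (A : Type*) [CommRing A] [IsNoetherianRing A] [IsLocalRing A]
    (hdim : ringKrullDim A = 1)
    (hreg : ∃ a ∈ maximalIdeal A, a ∈ nonZeroDivisors A)
    (hGor : IsGorensteinOneDim A)
    (hnotreg : ¬ (maximalIdeal A).IsPrincipal) :
    ∃ (ι : A →ₗ[A] stabilizerOfMaximalIdeal A)
      (π : stabilizerOfMaximalIdeal A →ₗ[A] (A ⧸ maximalIdeal A)),
      (∀ a : A, (ι a : Localization (nonZeroDivisors A)) =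
        algebraMap A (Localization (nonZeroDivisors A)) a) ∧
      Function.Injective ι ∧ Function.Surjective π ∧ Function.Exact ι π := by
  obtain ⟨π, hπ, hker⟩ := exists_stab_to_ext A hreg hnotreg
  obtain ⟨e⟩ := hGor.2
  have hinj := IsLocalization.injective (Localization (nonZeroDivisors A))
    (le_refl (nonZeroDivisors A))
  refine ⟨(Algebra.linearMap A (Localization (nonZeroDivisors A))).codRestrict _ ?_,
    e.toLinearEquiv.toLinearMap ∘ₗ π, ?_, ?_, ?_, ?_⟩
  · intro c a ha
    exact ⟨c * a, Ideal.mul_mem_left _ _ ha, by rw [map_mul]; rfl⟩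
  · intro a
    rfl
  · intro a b hab
    exact hinj (congrArg Subtype.val hab)
  · exact e.toLinearEquiv.surjective.comp hπ
  · intro r
    rw [LinearMap.comp_apply, LinearEquiv.coe_coe, LinearEquiv.map_eq_zero_iff, hker]
    constructor
    · rintro ⟨a, ha⟩
      exact ⟨a, Subtype.ext ha⟩
    · rintro ⟨a, ha⟩
      exact ⟨a, congrArg Subtype.val ha⟩
end

section
/- Let k be a field, let A = k[[x,y,u,v]]/(xy, yu, uv, vx, u^2, v^2), and let P = k[[x,y,z]]/(xy, z^2). Then the k-algebra homomorphism P → A sending x ↦ x, y ↦ y, z ↦ u + v is well-defined and injective. -/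
set_option synthInstance.maxHeartbeats 400000

open MvPowerSeries

/-- The ideal `(xy, yu, uv, vx, u², v²)` of `k[[x,y,u,v]]`, where
`x = X 0`, `y = X 1`, `u = X 2`, `v = X 3`. -/
noncomputable def Aideal (k : Type*) [Field k] : Ideal (MvPowerSeries (Fin 4) k) :=
  Ideal.span {(X 0 : MvPowerSeries (Fin 4) k) * X 1,
    (X 1 : MvPowerSeries (Fin 4) k) * X 2,
    (X 2 : MvPowerSeries (Fin 4) k) * X 3,
    (X 3 : MvPowerSeries (Fin 4) k) * X 0,
    (X 2 : MvPowerSeries (Fin 4) k) ^ 2,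
    (X 3 : MvPowerSeries (Fin 4) k) ^ 2}

theorem aux_hasSubst_P (k : Type*) [Field k] :
    HasSubst (![X 0, X 1, X 2 + X 3] : Fin 3 → MvPowerSeries (Fin 4) k) :=
  hasSubst_of_constantCoeff_zero (by intro s; fin_cases s <;> simp)

theorem aux_hasSubst_one (k : Type*) [Field k] :
    HasSubst (![X 0, 0, X 2, 0] : Fin 4 → MvPowerSeries (Fin 3) k) :=
  hasSubst_of_constantCoeff_zero (by intro s; fin_cases s <;> simp)

theorem aux_hasSubst_two (k : Type*) [Field k] :
    HasSubst (![0, X 1, 0, X 2] : Fin 4 → MvPowerSeries (Fin 3) k) :=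
  hasSubst_of_constantCoeff_zero (by intro s; fin_cases s <;> simp)

theorem aux_back_one (k : Type*) [Field k] (f : MvPowerSeries (Fin 4) k) (hf : f ∈ Aideal k) :
    (X 2 : MvPowerSeries (Fin 3) k) ^ 2 ∣ substAlgHom (R := k) (aux_hasSubst_one k) f := by
  rw [← Ideal.mem_span_singleton, ← Ideal.mem_comap]
  revert hf
  apply Ideal.span_le.2
  rintro g (rfl | rfl | rfl | rfl | rfl | rfl) <;>
    simp [Ideal.mem_span_singleton, subst_X (aux_hasSubst_one k), subst_mul (aux_hasSubst_one k), subst_pow (aux_hasSubst_one k)]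

theorem aux_back_two (k : Type*) [Field k] (f : MvPowerSeries (Fin 4) k) (hf : f ∈ Aideal k) :
    (X 2 : MvPowerSeries (Fin 3) k) ^ 2 ∣ substAlgHom (R := k) (aux_hasSubst_two k) f := by
  rw [← Ideal.mem_span_singleton, ← Ideal.mem_comap]
  revert hf
  apply Ideal.span_le.2
  rintro g (rfl | rfl | rfl | rfl | rfl | rfl) <;>
    simp [Ideal.mem_span_singleton, subst_X (aux_hasSubst_two k), subst_mul (aux_hasSubst_two k), subst_pow (aux_hasSubst_two k)]

theorem aux_comp_one (k : Type*) [Field k] (f : MvPowerSeries (Fin 3) k) :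
    substAlgHom (R := k) (aux_hasSubst_one k) (substAlgHom (R := k) (aux_hasSubst_P k) f) =
      rescale ![1, 0, 1] f := by
  rw [coe_substAlgHom, coe_substAlgHom,
    subst_comp_subst_apply (aux_hasSubst_P k) (aux_hasSubst_one k), rescale_eq_subst]
  congr 1
  funext s
  fin_cases s <;>
    simp [subst_X (aux_hasSubst_one k), subst_add (aux_hasSubst_one k)]

theorem aux_comp_two (k : Type*) [Field k] (f : MvPowerSeries (Fin 3) k) :
    substAlgHom (R := k) (aux_hasSubst_two k) (substAlgHom (R := k) (aux_hasSubst_P k) f) =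
      rescale ![0, 1, 1] f := by
  rw [coe_substAlgHom, coe_substAlgHom,
    subst_comp_subst_apply (aux_hasSubst_P k) (aux_hasSubst_two k), rescale_eq_subst]
  congr 1
  funext s
  fin_cases s <;>
    simp [subst_X (aux_hasSubst_two k), subst_add (aux_hasSubst_two k)]

/-- A series whose coefficients vanish at all standard monomials lies in `(xy, z²)`. -/
theorem aux_mem (k : Type*) [Field k] (f : MvPowerSeries (Fin 3) k)
    (h : ∀ e : Fin 3 →₀ ℕ, e 2 < 2 → (e 0 = 0 ∨ e 1 = 0) → coeff e f = 0) :
    f ∈ Ideal.span {(X 0 : MvPowerSeries (Fin 3) k) * X 1,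
          (X 2 : MvPowerSeries (Fin 3) k) ^ 2} := by
  obtain ⟨g, hg⟩ : ∃ g : MvPowerSeries (Fin 3) k,
      ∀ e, coeff e g = if e 2 < 2 then coeff e f else 0 :=
    ⟨fun e => if e 2 < 2 then coeff e f else 0, fun e => rfl⟩
  have h2 : (X 2 : MvPowerSeries (Fin 3) k) ^ 2 ∣ f - g := by
    rw [X_pow_dvd_iff]
    intro m hm
    simp [hg, hm]
  have h0 : (X 0 : MvPowerSeries (Fin 3) k) ∣ g := by
    rw [X_dvd_iff]
    intro m hm
    rw [hg]
    split_ifs with h'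
    · exact h m h' (Or.inl hm)
    · rfl
  obtain ⟨g', rfl⟩ := h0
  have h1 : (X 1 : MvPowerSeries (Fin 3) k) ∣ g' := by
    rw [X_dvd_iff]
    intro m hm
    have := hg (Finsupp.single 0 1 + m)
    rw [X, coeff_add_monomial_mul, one_mul] at this
    rw [this]
    split_ifs with h'
    · exact h _ h' (Or.inr (by simp [hm]))
    · rfl
  obtain ⟨b, rfl⟩ := h1
  obtain ⟨c, hc⟩ := h2
  rw [Ideal.mem_span_pair]
  exact ⟨b, c, by linear_combination -hc⟩

theorem aux_injective (k : Type*) [Field k] (f : MvPowerSeries (Fin 3) k)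
    (hf : substAlgHom (R := k) (aux_hasSubst_P k) f ∈ Aideal k) :
    f ∈ Ideal.span {(X 0 : MvPowerSeries (Fin 3) k) * X 1,
          (X 2 : MvPowerSeries (Fin 3) k) ^ 2} := by
  have h1 := aux_back_one k _ hf
  have h2 := aux_back_two k _ hf
  rw [aux_comp_one, X_pow_dvd_iff] at h1
  rw [aux_comp_two, X_pow_dvd_iff] at h2
  apply aux_mem
  rintro e he (h | h)
  · have := h2 e he
    rw [coeff_rescale, Finsupp.prod_fintype _ _ (by simp)] at this
    simpa [Fin.prod_univ_three, h] using this
  · have := h1 e he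
    rw [coeff_rescale, Finsupp.prod_fintype _ _ (by simp)] at this
    simpa [Fin.prod_univ_three, h] using this

theorem aux_welldefined (k : Type*) [Field k] (f : MvPowerSeries (Fin 3) k)
    (hf : f ∈ Ideal.span {(X 0 : MvPowerSeries (Fin 3) k) * X 1,
          (X 2 : MvPowerSeries (Fin 3) k) ^ 2}) :
    substAlgHom (R := k) (aux_hasSubst_P k) f ∈ Aideal k := by
  rw [← Ideal.mem_comap]
  revert hf
  apply Ideal.span_le.2
  rintro g (rfl | rfl)
  · simp only [SetLike.mem_coe, Ideal.mem_comap, map_mul, substAlgHom_X]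
    exact Ideal.subset_span (by simp)
  · simp only [SetLike.mem_coe, Ideal.mem_comap, map_pow, substAlgHom_X]
    have a : (X 2 : MvPowerSeries (Fin 4) k) ^ 2 ∈ Aideal k := Ideal.subset_span (by simp)
    have b : (X 3 : MvPowerSeries (Fin 4) k) ^ 2 ∈ Aideal k := Ideal.subset_span (by simp)
    have c : (X 2 : MvPowerSeries (Fin 4) k) * X 3 ∈ Aideal k := Ideal.subset_span (by simp)
    have := add_mem (add_mem a b) (Ideal.mul_mem_left _ 2 c)
    convert this using 1
    simp
    ring

/-- Let `k` be a field, `A = k[[x,y,u,v]]/(xy, yu, uv, vx, u², v²)` and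
`P = k[[x,y,z]]/(xy, z²)`.  Then the `k`-algebra homomorphism `P → A` sending `x ↦ x`,
`y ↦ y`, `z ↦ u + v` is well-defined (i.e. exists) and injective. -/
theorem P_to_A_welldefined_injective (k : Type*) [Field k] :
    ∃ φ : (MvPowerSeries (Fin 3) k ⧸
        Ideal.span {(X 0 : MvPowerSeries (Fin 3) k) * X 1,
          (X 2 : MvPowerSeries (Fin 3) k) ^ 2}) →ₐ[k]
      (MvPowerSeries (Fin 4) k ⧸ Aideal k),
      φ (Ideal.Quotient.mk _ (X 0)) = Ideal.Quotient.mk _ (X 0) ∧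
      φ (Ideal.Quotient.mk _ (X 1)) = Ideal.Quotient.mk _ (X 1) ∧
      φ (Ideal.Quotient.mk _ (X 2)) =
        Ideal.Quotient.mk _ (X 2) + Ideal.Quotient.mk _ (X 3) ∧
      Function.Injective φ := by
  refine ⟨Ideal.Quotient.liftₐ _
    ((Ideal.Quotient.mkₐ k (Aideal k)).comp (substAlgHom (R := k) (aux_hasSubst_P k)))
    (fun f hf => Ideal.Quotient.eq_zero_iff_mem.2 (aux_welldefined k f hf)), ?_, ?_, ?_, ?_⟩
  · change Ideal.Quotient.mk _ (substAlgHom (R := k) (aux_hasSubst_P k) (X 0)) = _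
    rw [substAlgHom_X]; rfl
  · change Ideal.Quotient.mk _ (substAlgHom (R := k) (aux_hasSubst_P k) (X 1)) = _
    rw [substAlgHom_X]; rfl
  · change Ideal.Quotient.mk _ (substAlgHom (R := k) (aux_hasSubst_P k) (X 2)) = _
    rw [substAlgHom_X]; rfl
  · rw [injective_iff_map_eq_zero]
    intro p hp
    obtain ⟨f, rfl⟩ := Ideal.Quotient.mk_surjective p
    exact Ideal.Quotient.eq_zero_iff_mem.2
      (aux_injective k f (Ideal.Quotient.eq_zero_iff_mem.1 hp))
end
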